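/- arXiv:2001.02670 — 2 statements merged into one kernel-verified Lean document; each statement's English description precedes it below -/
import Mathlib

section
/- Let n and f be natural numbers and let (t_d(k), t_u(k)) for k = 0, 1, 2, … be a sequence of pairs of integers with t_d(0) = n − f and t_u(0) = n, such that for every k the pair (t_d(k+1), t_u(k+1)) is obtained from (t_d(k), t_u(k)) by either a master update or a slave update. Then for every k ≥ 0, 2^k · (t_u(k) − t_d(k)) ≤ f. -/
/-- starting from `t_d = n − f`, `t_u = n`, after `k` master/slave
updates the gap satisfies `2^k * (t_u(k) − t_d(k)) ≤ f`. -/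
theorem stmt5 (n f : ℕ) (td tu : ℕ → ℤ)
    (h0d : td 0 = (n : ℤ) - (f : ℤ)) (h0u : tu 0 = (n : ℤ))
    (hupd : ∀ k, (td (k + 1) = td k + (tu k - td k) / 2 + 1 ∧ tu (k + 1) = tu k) ∨
                 (td (k + 1) = td k ∧ tu (k + 1) = td k + (tu k - td k) / 2)) :
    ∀ k, 2 ^ k * (tu k - td k) ≤ (f : ℤ) := by
  intro k
  induction k with
  | zero => simp [h0d, h0u]
  | succ k ih =>
    have halved : 2 * (tu (k + 1) - td (k + 1)) ≤ tu k - td k := by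
      rcases hupd k with ⟨hd, hu⟩ | ⟨hd, hu⟩ <;> omega
    calc (2 : ℤ) ^ (k + 1) * (tu (k + 1) - td (k + 1))
        = 2 ^ k * (2 * (tu (k + 1) - td (k + 1))) := by ring
      _ ≤ 2 ^ k * (tu k - td k) := by gcongr
      _ ≤ f := ih
end

section
/- Let n and f be natural numbers and let (t_d(k), t_u(k)) for k = 0, 1, 2, … be a sequence of pairs of integers with t_d(0) = n − f and t_u(0) = n, such that for every k the pair (t_d(k+1), t_u(k+1)) is obtained from (t_d(k), t_u(k)) by either a master update or a slave update. Then for every k with 2^k > f, one has t_u(k) ≤ t_d(k). -/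
/-- starting from `t_d = n − f`, `t_u = n`, once `2^k > f` the gap
is closed: `t_u(k) ≤ t_d(k)`. -/
theorem stmt6 (n f : ℕ) (td tu : ℕ → ℤ)
    (h0d : td 0 = (n : ℤ) - (f : ℤ)) (h0u : tu 0 = (n : ℤ))
    (hupd : ∀ k, (td (k + 1) = td k + (tu k - td k) / 2 + 1 ∧ tu (k + 1) = tu k) ∨
                 (td (k + 1) = td k ∧ tu (k + 1) = td k + (tu k - td k) / 2)) :
    ∀ k, f < 2 ^ k → tu k ≤ td k := by
  have gap_le : ∀ k, 2 ^ k * (tu k - td k) ≤ (f : ℤ) := by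
    intro k
    induction k with
    | zero => rw [h0d, h0u]; simp
    | succ k ih =>
      have gap_halves : 2 * (tu (k + 1) - td (k + 1)) ≤ tu k - td k := by
        rcases hupd k with ⟨hd, hu⟩ | ⟨hd, hu⟩ <;> rw [hd, hu] <;> omega
      calc (2 : ℤ) ^ (k + 1) * (tu (k + 1) - td (k + 1))
          = 2 ^ k * (2 * (tu (k + 1) - td (k + 1))) := by ring
        _ ≤ 2 ^ k * (tu k - td k) := by gcongr
        _ ≤ f := ih
  intro k hk
  have hk' : (f : ℤ) < 2 ^ k := by exact_mod_cast hk
  by_contra! hlt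
  have : (2 : ℤ) ^ k * 1 ≤ 2 ^ k * (tu k - td k) := by
    gcongr
    omega
  linarith [gap_le k]
end
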